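/- arXiv:1405.5765 — 7 statements merged into one kernel-verified Lean document; each statement's English description precedes it below -/
import Mathlib

section
/- Let φ, φ′ ∈ Matrix (Fin 2) (Fin 2) ℂ be trace-free (trace φ = trace φ′ = 0), normal (φ · φ* = φ* · φ and φ′ · (φ′)* = (φ′)* · φ′, where * denotes conjugate transpose), and suppose det φ = det φ′. Then there exists g ∈ SU(2) (i.e. g unitary with det g = 1) such that g⁻¹ · φ · g = φ′. -/
open scoped Matrix

open Matrix

/-- Every nonzero vector of `ℂ²` spans the same line as the first column of a special unitary
matrix. -/
theorem exists_mem_specialUnitaryGroup_mulVec_single {v : Fin 2 → ℂ} (hv : v ≠ 0) :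
    ∃ U ∈ specialUnitaryGroup (Fin 2) ℂ, ∃ c : ℂ, U.col 0 = c • v := by
  set r : ℝ := Complex.normSq (v 0) + Complex.normSq (v 1) with hr
  have hpos : 0 < r := by
    have h0 := Complex.normSq_nonneg (v 0)
    have h1 := Complex.normSq_nonneg (v 1)
    refine lt_of_le_of_ne (add_nonneg h0 h1) fun h => hv ?_
    have hz0 : v 0 = 0 := Complex.normSq_eq_zero.1 (by linarith)
    have hz1 : v 1 = 0 := Complex.normSq_eq_zero.1 (by linarith)
    ext i
    fin_cases i
    · exact hz0
    · exact hz1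
  have hs : (((√r)⁻¹ : ℝ) : ℂ) * ((√r)⁻¹ : ℝ) * (v 0 * star (v 0) + v 1 * star (v 1)) = 1 := by
    have h : (√r)⁻¹ * (√r)⁻¹ * r = 1 := by
      rw [← mul_inv, Real.mul_self_sqrt hpos.le, inv_mul_cancel₀ hpos.ne']
    simp only [Complex.star_def, Complex.mul_conj]
    exact_mod_cast h
  set c : ℂ := (((√r)⁻¹ : ℝ) : ℂ)
  have hcs : star c = c := Complex.conj_ofReal _
  refine ⟨!![c * v 0, -(c * star (v 1)); c * v 1, c * star (v 0)], ?_, c, ?_⟩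
  · rw [mem_specialUnitaryGroup_iff, mem_unitaryGroup_iff, det_fin_two_of]
    refine ⟨?_, by linear_combination hs⟩
    ext i j
    fin_cases i <;> fin_cases j <;>
      simp only [mul_apply, Fin.sum_univ_two, star_apply, star_mul', star_neg, star_star, hcs,
        of_apply, cons_val', cons_val_zero, cons_val_one, cons_val_fin_one, Fin.zero_eta,
        Fin.mk_one, one_apply_eq, ne_eq, zero_ne_one, one_ne_zero, not_false_eq_true,
        one_apply_ne]
    · linear_combination hs
    · ring
    · ring
    · linear_combination hs
  · ext i
    fin_cases i <;> simp

/-- A normal upper triangular `2 × 2` complex matrix is diagonal. -/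
theorem apply_zero_one_eq_zero_of_normal {M : Matrix (Fin 2) (Fin 2) ℂ}
    (hn : M * Mᴴ = Mᴴ * M) (h : M 1 0 = 0) : M 0 1 = 0 := by
  have h00 := congrFun (congrFun hn 0) 0
  simp only [mul_apply, Fin.sum_univ_two, conjTranspose_apply, h, star_zero, zero_mul,
    add_zero] at h00
  have : M 0 1 * star (M 0 1) = 0 := by linear_combination h00
  simpa using this

/-- A trace-free normal `2 × 2` complex matrix is diagonalized by a special unitary matrix, with
the two square roots of minus the determinant on the diagonal, in either order. -/
theorem exists_mem_specialUnitaryGroup_conj_eq_diagonal {φ : Matrix (Fin 2) (Fin 2) ℂ}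
    (htr : φ.trace = 0) (hn : φ * φᴴ = φᴴ * φ) {d : ℂ} (hd : d ^ 2 = -φ.det) :
    ∃ U ∈ specialUnitaryGroup (Fin 2) ℂ, star U * φ * U = diagonal ![d, -d] := by
  have hsing : (φ - d • (1 : Matrix (Fin 2) (Fin 2) ℂ)).det = 0 := by
    rw [trace_fin_two] at htr
    rw [det_fin_two] at hd ⊢
    simp only [Matrix.sub_apply, Matrix.smul_apply, one_apply_eq, one_apply_ne, ne_eq, zero_ne_one,
      one_ne_zero, not_false_eq_true, smul_eq_mul]
    linear_combination hd - d * htr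
  obtain ⟨v, hv, hφv⟩ := exists_mulVec_eq_zero_iff.2 hsing
  rw [sub_mulVec, smul_mulVec, one_mulVec, sub_eq_zero] at hφv
  obtain ⟨U, hU, c, hUc⟩ := exists_mem_specialUnitaryGroup_mulVec_single hv
  refine ⟨U, hU, ?_⟩
  have hUu := (mem_specialUnitaryGroup_iff.1 hU).1
  have hl : star U * U = 1 := mem_unitaryGroup_iff'.1 hUu
  have hr : U * star U = 1 := mem_unitaryGroup_iff.1 hUu
  set M := star U * φ * U with hM
  have hcol : M.col 0 = d • Pi.single 0 1 := by
    rw [← mulVec_single_one, hM, ← mulVec_mulVec, mulVec_single_one, hUc, mulVec_smul,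
      ← mulVec_mulVec, hφv, mulVec_smul, smul_comm, ← mulVec_smul, ← hUc, ← mulVec_single_one,
      mulVec_mulVec, hl, one_mulVec]
  have h00 : M 0 0 = d := by simpa using congrFun hcol 0
  have h10 : M 1 0 = 0 := by simpa using congrFun hcol 1
  have hMtr : M.trace = 0 := by
    rw [hM, trace_mul_comm, ← mul_assoc, hr, one_mul, htr]
  have h11 : M 1 1 = -d := by
    rw [trace_fin_two, h00] at hMtr
    linear_combination hMtr
  have hMn : M * Mᴴ = Mᴴ * M := by
    have hMs : Mᴴ = star U * φᴴ * U := by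
      simp only [hM, star_eq_conjTranspose, conjTranspose_mul, conjTranspose_conjTranspose,
        mul_assoc]
    calc M * Mᴴ = star U * φ * (U * star U) * φᴴ * U := by rw [hMs, hM]; noncomm_ring
      _ = star U * (φ * φᴴ) * U := by rw [hr]; noncomm_ring
      _ = star U * φᴴ * (U * star U) * φ * U := by rw [hn, hr]; noncomm_ring
      _ = Mᴴ * M := by rw [hMs, hM]; noncomm_ring
  have h01 := apply_zero_one_eq_zero_of_normal hMn h10
  ext i j
  fin_cases i <;> fin_cases j <;> simp [h00, h01, h10, h11]

/-- Two trace-free normal 2×2 complex matrices with the same determinant are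
conjugate by a special unitary matrix. -/
theorem normal_tracefree_conjugate_of_det_eq
    (φ φ' : Matrix (Fin 2) (Fin 2) ℂ)
    (htr : φ.trace = 0) (htr' : φ'.trace = 0)
    (hn : φ * φᴴ = φᴴ * φ) (hn' : φ' * φ'ᴴ = φ'ᴴ * φ')
    (hdet : φ.det = φ'.det) :
    ∃ g : Matrix (Fin 2) (Fin 2) ℂ,
      g ∈ Matrix.unitaryGroup (Fin 2) ℂ ∧ g.det = 1 ∧ g⁻¹ * φ * g = φ' := by
  obtain ⟨d, hd⟩ := IsAlgClosed.exists_pow_nat_eq (-φ.det) two_pos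
  obtain ⟨U, hU, hUφ⟩ := exists_mem_specialUnitaryGroup_conj_eq_diagonal htr hn hd
  obtain ⟨V, hV, hVφ⟩ := exists_mem_specialUnitaryGroup_conj_eq_diagonal htr' hn' (hdet ▸ hd)
  have hg : U * star V ∈ specialUnitaryGroup (Fin 2) ℂ :=
    mul_mem hU (star (⟨V, hV⟩ : specialUnitaryGroup (Fin 2) ℂ)).2
  obtain ⟨hgu, hgd⟩ := mem_specialUnitaryGroup_iff.1 hg
  have hVr : V * star V = 1 := mem_unitaryGroup_iff.1 (mem_specialUnitaryGroup_iff.1 hV).1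
  refine ⟨U * star V, hgu, hgd, ?_⟩
  rw [inv_eq_left_inv (mem_unitaryGroup_iff'.1 hgu), star_mul, star_star]
  calc V * star U * φ * (U * star V) = V * (star U * φ * U) * star V := by noncomm_ring
    _ = (V * star V) * φ' * (V * star V) := by rw [hUφ, ← hVφ]; noncomm_ring
    _ = φ' := by rw [hVr, one_mul, mul_one]
end

section
/- Let a, b, c be holomorphic functions on an open disk D ⊆ ℂ centered at 0 with b(0) ≠ 0, and set φ(z) = [[a(z), b(z)], [c(z), −a(z)]]. Then there exist an open neighborhood U ⊆ D of 0 and a holomorphic map g : U → Matrix (Fin 2) (Fin 2) ℂ with det g(z) = 1 for all z ∈ U, such that g(z)⁻¹ · φ(z) · g(z) = [[0, 1], [−det φ(z), 0]] for all z ∈ U. Explicitly one may take g(z) = (1/√(b(z))) · [[b(z), 0], [−a(z), 1]] for a holomorphic branch √(b(z)) of the square root of b near 0. -/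
open scoped Matrix

/-- A function holomorphic and nonvanishing at a point has a holomorphic square root near it. -/
theorem DifferentiableOn.exists_isOpen_sq_eq {s : Set ℂ} {f : ℂ → ℂ} {x : ℂ}
    (hf : DifferentiableOn ℂ f s) (hs : IsOpen s) (hx : x ∈ s) (hfx : f x ≠ 0) :
    ∃ U ⊆ s, IsOpen U ∧ x ∈ U ∧ ∃ r : ℂ → ℂ, DifferentiableOn ℂ r U ∧
      ∀ z ∈ U, r z ≠ 0 ∧ r z ^ 2 = f z := by
  obtain ⟨w, hw⟩ := IsAlgClosed.exists_pow_nat_eq (f x) two_pos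
  have hw0 : w ≠ 0 := by
    rintro rfl
    exact hfx (by simpa using hw.symm)
  have hq : DifferentiableOn ℂ (fun z => f z / f x) s := hf.div_const _
  refine ⟨s ∩ (fun z => f z / f x) ⁻¹' Complex.slitPlane, Set.inter_subset_left,
    hq.continuousOn.isOpen_inter_preimage hs Complex.isOpen_slitPlane,
    ⟨hx, by simp [hfx]⟩, fun z => w * Complex.exp (Complex.log (f z / f x) / 2), ?_, ?_⟩
  · exact ((((hq.mono Set.inter_subset_left).clog fun z hz => hz.2).div_const 2).cexp).const_mul w
  · intro z hz
    refine ⟨mul_ne_zero hw0 (Complex.exp_ne_zero _), ?_⟩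
    rw [mul_pow, hw, ← Complex.exp_nat_mul, Nat.cast_ofNat, mul_div_cancel₀ _ two_ne_zero,
      Complex.exp_log (Complex.slitPlane_ne_zero hz.2), mul_div_cancel₀ _ hfx]

/-- Near a point where `b(0) ≠ 0`, the trace-free holomorphic matrix
`φ(z) = [[a z, b z],[c z, -a z]]` can be put into the companion normal form
`[[0, 1], [-det φ, 0]]` by a holomorphic unimodular gauge transformation,
explicitly `g(z) = (1/√(b z)) · [[b z, 0],[-a z, 1]]`. -/
theorem higgs_field_normal_form
    (R : ℝ) (hR : 0 < R) (a b c : ℂ → ℂ)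
    (ha : DifferentiableOn ℂ a (Metric.ball (0 : ℂ) R))
    (hb : DifferentiableOn ℂ b (Metric.ball (0 : ℂ) R))
    (hc : DifferentiableOn ℂ c (Metric.ball (0 : ℂ) R))
    (hb0 : b 0 ≠ 0)
    (φ : ℂ → Matrix (Fin 2) (Fin 2) ℂ)
    (hφ : ∀ z ∈ Metric.ball (0 : ℂ) R, φ z = !![a z, b z; c z, -a z]) :
    ∃ U : Set ℂ, IsOpen U ∧ (0 : ℂ) ∈ U ∧ U ⊆ Metric.ball (0 : ℂ) R ∧
      ∃ g : ℂ → Matrix (Fin 2) (Fin 2) ℂ,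
        (∀ i j : Fin 2, DifferentiableOn ℂ (fun z => g z i j) U) ∧
        (∀ z ∈ U, (g z).det = 1) ∧
        (∀ z ∈ U, (g z)⁻¹ * φ z * g z = !![0, 1; -(φ z).det, 0]) ∧
        ∃ sb : ℂ → ℂ, DifferentiableOn ℂ sb U ∧
          ∀ z ∈ U, sb z ^ 2 = b z ∧ g z = (sb z)⁻¹ • !![b z, 0; -a z, 1] := by
  obtain ⟨U, hUs, hUo, h0U, r, hr, hrb⟩ :=
    hb.exists_isOpen_sq_eq Metric.isOpen_ball (Metric.mem_ball_self hR) hb0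
  have hdet : ∀ z ∈ U, ((r z)⁻¹ • !![b z, 0; -a z, 1]).det = 1 := by
    intro z hz
    obtain ⟨h0, h2⟩ := hrb z hz
    rw [← h2]
    simp [Matrix.det_fin_two]
    field_simp
  refine ⟨U, hUo, h0U, hUs, fun z => (r z)⁻¹ • !![b z, 0; -a z, 1], ?_, hdet, ?_, r, hr,
    fun z hz => ⟨(hrb z hz).2, rfl⟩⟩
  · have hri : DifferentiableOn ℂ (fun z => (r z)⁻¹) U := hr.inv fun z hz => (hrb z hz).1
    intro i j
    fin_cases i <;> fin_cases j
    · simpa using hri.fun_mul (hb.mono hUs)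
    · simp
    · simpa using hri.fun_mul (ha.mono hUs)
    · simpa using hri
  · intro z hz
    obtain ⟨h0, h2⟩ := hrb z hz
    have hu : IsUnit ((r z)⁻¹ • !![b z, 0; -a z, 1]).det := by simp only [hdet z hz, isUnit_one]
    have key : φ z * ((r z)⁻¹ • !![b z, 0; -a z, 1]) =
        ((r z)⁻¹ • !![b z, 0; -a z, 1]) * !![0, 1; -(φ z).det, 0] := by
      rw [hφ z (hUs hz)]
      ext i j
      fin_cases i <;> fin_cases j <;> simp [Matrix.mul_apply, Fin.sum_univ_two] <;> ring
    rw [Matrix.mul_assoc, key, Matrix.nonsing_inv_mul_cancel_left _ _ hu]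
end

section
/- Let v, w : (0,1) × ℝ → ℂ be smooth functions, 2π-periodic in the second variable θ, satisfying the compatibility relation ∂_r v = ∂_θ w + (i/2)·w on (0,1) × ℝ. Then there exists a smooth function μ : (0,1) × ℝ → ℂ, 2π-periodic in θ, such that simultaneously −i·∂_θ μ + (1/2)·μ = i·v and ∂_r μ = −w. Moreover, if in addition e^{iθ}·v(r,θ) + conj(v(r,θ)) = 0 for all (r,θ), then the solution μ satisfies e^{iθ}·μ(r,θ) + conj(μ(r,θ)) = 0 for all (r,θ). -/
open Complex

section ParametricIntegral

open Set Function Topology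

variable {E G : Type*} [NormedAddCommGroup E] [NormedSpace ℝ E]
  [NormedAddCommGroup G] [NormedSpace ℝ G]

theorem hasFDerivAt_intervalIntegral_of_contDiffOn {U : Set E} (hU : IsOpen U)
    {F : E → ℝ → G} (hF : ContDiffOn ℝ 1 (uncurry F) (U ×ˢ univ)) (a b : ℝ) {x₀ : E}
    (hx₀ : x₀ ∈ U) :
    HasFDerivAt (fun x ↦ ∫ t in a..b, F x t)
      (∫ t in a..b, (fderiv ℝ (uncurry F) (x₀, t)).comp (ContinuousLinearMap.inl ℝ E ℝ)) x₀ := by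
  have hUo : IsOpen (U ×ˢ (univ : Set ℝ)) := hU.prod isOpen_univ
  set F' : E → ℝ → E →L[ℝ] G := fun x t ↦
    (fderiv ℝ (uncurry F) (x, t)).comp (ContinuousLinearMap.inl ℝ E ℝ) with hF'
  have hF'c : ContinuousOn (uncurry F') (U ×ˢ univ) :=
    (hF.continuousOn_fderiv_of_isOpen hUo le_rfl).clm_comp continuousOn_const
  have slice {x : E} (hx : x ∈ U) : MapsTo (fun t : ℝ ↦ (x, t)) univ (U ×ˢ univ) :=
    fun t _ ↦ ⟨hx, mem_univ t⟩
  have hFx {x : E} (hx : x ∈ U) : Continuous (F x) :=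
    continuousOn_univ.1 (hF.continuousOn.comp (Continuous.prodMk_right x).continuousOn (slice hx))
  have hF'x {x : E} (hx : x ∈ U) : Continuous (F' x) :=
    continuousOn_univ.1 (hF'c.comp (Continuous.prodMk_right x).continuousOn (slice hx))
  obtain ⟨M, hM⟩ := (isCompact_uIcc (a := a) (b := b)).exists_bound_of_continuousOn
    (hF'x hx₀).continuousOn
  obtain ⟨V, W, hV, -, hxV, hW, hVW⟩ := generalized_tube_lemma
    (isCompact_singleton (x := x₀)) (isCompact_uIcc (a := a) (b := b))
    (hF'c.norm.isOpen_inter_preimage hUo (isOpen_Iio (a := M + 1))) (by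
      rintro ⟨x, t⟩ ⟨hx, ht⟩
      obtain rfl : x = x₀ := hx
      exact ⟨⟨hx₀, mem_univ t⟩, (hM t ht).trans_lt (lt_add_one M)⟩)
  refine intervalIntegral.hasFDerivAt_integral_of_dominated_of_fderiv_le (F' := F')
    (bound := fun _ ↦ M + 1) (s := U ∩ V)
    (Filter.inter_mem (hU.mem_nhds hx₀) (hV.mem_nhds (hxV rfl)))
    ((hU.eventually_mem hx₀).mono fun x hx ↦ (hFx hx).aestronglyMeasurable)
    ((hFx hx₀).intervalIntegrable a b) (hF'x hx₀).aestronglyMeasurable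
    (.of_forall fun t ht x hx ↦ ?_) intervalIntegrable_const (.of_forall fun t _ x hx ↦ ?_)
  · exact (hVW (mk_mem_prod hx.2 (hW (uIoc_subset_uIcc ht)))).2.le
  · have hd : HasFDerivAt (uncurry F) (fderiv ℝ (uncurry F) (x, t)) (x, t) :=
      ((hF.differentiableOn one_ne_zero).differentiableAt
        (hUo.mem_nhds ⟨hx.1, mem_univ t⟩)).hasFDerivAt
    exact hd.comp (f := fun y ↦ (y, t)) x (hasFDerivAt_prodMk_left x t)

theorem hasDerivAt_intervalIntegral_of_contDiffOn {U : Set ℝ} (hU : IsOpen U)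
    {F : ℝ → ℝ → G} (hF : ContDiffOn ℝ 1 (uncurry F) (U ×ˢ univ)) (a b : ℝ) {x₀ : ℝ}
    (hx₀ : x₀ ∈ U) :
    HasDerivAt (fun x ↦ ∫ t in a..b, F x t) (∫ t in a..b, deriv (fun x ↦ F x t) x₀) x₀ := by
  have hUo : IsOpen (U ×ˢ (univ : Set ℝ)) := hU.prod isOpen_univ
  have hc : Continuous fun t ↦
      (fderiv ℝ (uncurry F) (x₀, t)).comp (ContinuousLinearMap.inl ℝ ℝ ℝ) :=
    continuousOn_univ.1 <| ((hF.continuousOn_fderiv_of_isOpen hUo le_rfl).comp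
      (Continuous.prodMk_right x₀).continuousOn
      fun t _ ↦ ⟨hx₀, mem_univ t⟩).clm_comp continuousOn_const
  convert (hasFDerivAt_intervalIntegral_of_contDiffOn hU hF a b hx₀).hasDerivAt using 1
  rw [ContinuousLinearMap.intervalIntegral_apply (hc.intervalIntegrable a b)]
  refine intervalIntegral.integral_congr fun t _ ↦ ?_
  have hd : HasFDerivAt (uncurry F) (fderiv ℝ (uncurry F) (x₀, t)) (x₀, t) :=
    ((hF.differentiableOn one_ne_zero).differentiableAt
      (hUo.mem_nhds ⟨hx₀, mem_univ t⟩)).hasFDerivAt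
  exact (hd.comp (f := fun y ↦ (y, t)) x₀ (hasFDerivAt_prodMk_left x₀ t)).hasDerivAt.deriv

end ParametricIntegral

open Set Function in
theorem contDiffOn_nat_intervalIntegral {E G : Type} [NormedAddCommGroup E] [NormedSpace ℝ E]
    [NormedAddCommGroup G] [NormedSpace ℝ G] {U : Set E} (hU : IsOpen U) (n : ℕ)
    {F : E → ℝ → G} (hF : ContDiffOn ℝ n (uncurry F) (U ×ˢ univ)) (a b : ℝ) :
    ContDiffOn ℝ n (fun x ↦ ∫ t in a..b, F x t) U := by
  have hUo : IsOpen (U ×ˢ (univ : Set ℝ)) := hU.prod isOpen_univ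
  induction n generalizing G with
  | zero =>
    rw [Nat.cast_zero, contDiffOn_zero] at hF ⊢
    rw [continuousOn_iff_continuous_domRestrict]
    refine intervalIntegral.continuous_parametric_intervalIntegral_of_continuous'
      (f := fun (x : U) t ↦ F x t) ?_ a b
    exact hF.comp_continuous (f := fun p : U × ℝ ↦ ((p.1 : E), p.2)) (by fun_prop)
      fun p ↦ ⟨p.1.2, mem_univ _⟩
  | succ n ih =>
    have hder {x : E} (hx : x ∈ U) :=
      hasFDerivAt_intervalIntegral_of_contDiffOn hU (hF.of_le (by simp)) a b hx
    rw [Nat.cast_add, Nat.cast_one] at hF ⊢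
    refine (contDiffOn_succ_iff_fderiv_of_isOpen hU).2
      ⟨fun x hx ↦ (hder hx).differentiableAt.differentiableWithinAt, by simp, ?_⟩
    refine ContDiffOn.congr (ih ?_) fun x hx ↦ (hder hx).fderiv
    exact (hF.fderiv_of_isOpen hUo le_rfl).clm_comp contDiffOn_const

theorem hasDerivAt_exp_half (s : ℝ) :
    HasDerivAt (fun s : ℝ ↦ exp (I * s / 2)) (exp (I * s / 2) * (I / 2)) s := by
  have h : HasDerivAt (fun s : ℝ ↦ I * (s : ℂ) / 2) (I / 2) s := by
    simpa using ((hasDerivAt_id s).ofReal_comp.const_mul I).div_const 2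
  exact h.cexp

theorem integral_exp_half_mul_deriv_add_of_periodic {g : ℝ → ℂ} (hg : ContDiff ℝ 1 g)
    (hper : Function.Periodic g (2 * Real.pi)) (θ : ℝ) :
    ∫ s in (0 : ℝ)..2 * Real.pi, exp (I * s / 2) * (deriv g (θ + s) + I / 2 * g (θ + s)) =
      -2 * g θ := by
  have hd (s : ℝ) : HasDerivAt (fun s : ℝ ↦ exp (I * s / 2) * g (θ + s))
      (exp (I * s / 2) * (deriv g (θ + s) + I / 2 * g (θ + s))) s := by
    have h := (hasDerivAt_exp_half s).mul
      ((hg.differentiable one_ne_zero (θ + s)).hasDerivAt.comp_const_add θ s)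
    exact h.congr_deriv (by ring)
  have hc := hg.continuous
  have hc' := hg.continuous_deriv le_rfl
  rw [intervalIntegral.integral_eq_sub_of_hasDerivAt (fun s _ ↦ hd s)
    (Continuous.intervalIntegrable (by fun_prop) _ _), hper θ]
  have he : exp (I * (2 * Real.pi : ℝ) / 2) = -1 := by
    rw [← exp_pi_mul_I]; congr 1; push_cast; ring
  rw [he]
  simp
  ring

open Complex

/-- Solvability of the overdetermined system `Pμ = iv`, `∂_r μ = -w` on `(0,1) × ℝ`
(periodic in `θ`), given the compatibility relation `∂_r v = ∂_θ w + (i/2)w`; moreover the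
solution inherits the reality condition `e^{iθ}μ + conj μ = 0` from `v`. -/
theorem exists_mu_solving_overdetermined_system
    (v w : ℝ × ℝ → ℂ)
    (hv : ContDiffOn ℝ (⊤ : ℕ∞) v (Set.Ioo (0 : ℝ) 1 ×ˢ Set.univ))
    (hw : ContDiffOn ℝ (⊤ : ℕ∞) w (Set.Ioo (0 : ℝ) 1 ×ˢ Set.univ))
    (hvper : ∀ r θ : ℝ, v (r, θ + 2 * Real.pi) = v (r, θ))
    (hwper : ∀ r θ : ℝ, w (r, θ + 2 * Real.pi) = w (r, θ))
    (hcompat : ∀ r ∈ Set.Ioo (0 : ℝ) 1, ∀ θ : ℝ,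
      deriv (fun s => v (s, θ)) r = deriv (fun t => w (r, t)) θ + (I / 2) * w (r, θ)) :
    ∃ μ : ℝ × ℝ → ℂ,
      ContDiffOn ℝ (⊤ : ℕ∞) μ (Set.Ioo (0 : ℝ) 1 ×ˢ Set.univ) ∧
      (∀ r θ : ℝ, μ (r, θ + 2 * Real.pi) = μ (r, θ)) ∧
      (∀ r ∈ Set.Ioo (0 : ℝ) 1, ∀ θ : ℝ,
        -I * deriv (fun t => μ (r, t)) θ + (1 / 2) * μ (r, θ) = I * v (r, θ)) ∧
      (∀ r ∈ Set.Ioo (0 : ℝ) 1, ∀ θ : ℝ,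
        deriv (fun s => μ (s, θ)) r = -w (r, θ)) ∧
      ((∀ r ∈ Set.Ioo (0 : ℝ) 1, ∀ θ : ℝ,
          Complex.exp (I * θ) * v (r, θ) + starRingEnd ℂ (v (r, θ)) = 0) →
        ∀ r ∈ Set.Ioo (0 : ℝ) 1, ∀ θ : ℝ,
          Complex.exp (I * θ) * μ (r, θ) + starRingEnd ℂ (μ (r, θ)) = 0) := by
  have hO : IsOpen (Set.Ioo (0 : ℝ) 1 ×ˢ (Set.univ : Set ℝ)) := isOpen_Ioo.prod isOpen_univ
  have slice {f : ℝ × ℝ → ℂ} (hf : ContDiffOn ℝ (⊤ : ℕ∞) f (Set.Ioo (0 : ℝ) 1 ×ˢ Set.univ))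
      {r : ℝ} (hr : r ∈ Set.Ioo (0 : ℝ) 1) : ContDiff ℝ 1 fun t ↦ f (r, t) :=
    contDiffOn_univ.1 <| (hf.of_le (by simp)).comp
      (contDiff_prodMk_right r).contDiffOn fun t _ ↦ ⟨hr, Set.mem_univ t⟩
  have hexp : ContDiff ℝ (⊤ : ℕ∞) fun s : ℝ ↦ exp (I * s / 2) :=
    ((contDiff_const.mul ofRealCLM.contDiff).div_const 2).cexp
  have hF : ContDiffOn ℝ (⊤ : ℕ∞)
      (Function.uncurry fun (p : ℝ × ℝ) (s : ℝ) ↦ exp (I * s / 2) * v (p.1, p.2 + s))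
      ((Set.Ioo (0 : ℝ) 1 ×ˢ Set.univ) ×ˢ Set.univ) :=
    (hexp.comp contDiff_snd).contDiffOn.mul <|
      hv.comp (f := fun q : (ℝ × ℝ) × ℝ ↦ (q.1.1, q.1.2 + q.2)) (by fun_prop)
        fun q hq ↦ ⟨hq.1.1, Set.mem_univ _⟩
  refine ⟨fun p ↦ 1 / 2 * ∫ s in (0 : ℝ)..2 * Real.pi, exp (I * s / 2) * v (p.1, p.2 + s),
    ?_, ?_, ?_, ?_, ?_⟩
  · exact contDiffOn_const.mul <| contDiffOn_infty.2 fun n ↦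
      contDiffOn_nat_intervalIntegral hO n (contDiffOn_infty.1 hF n) _ _
  · intro r θ
    simp only [add_right_comm θ, hvper]
  · intro r hr θ
    have hvr := slice hv hr
    have h := (hasDerivAt_intervalIntegral_of_contDiffOn isOpen_univ
      (F := fun t s : ℝ ↦ exp (I * s / 2) * v (r, t + s))
      (((hexp.of_le (by simp)).comp contDiff_snd).mul
        (hvr.comp (contDiff_fst.add contDiff_snd))).contDiffOn
      0 (2 * Real.pi) (Set.mem_univ θ)).const_mul (1 / 2 : ℂ)
    have hd (s : ℝ) : deriv (fun t : ℝ ↦ exp (I * s / 2) * v (r, t + s)) θ =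
        exp (I * s / 2) * deriv (fun t ↦ v (r, t)) (θ + s) := by
      rw [deriv_const_mul_field, deriv_comp_add_const (fun t ↦ v (r, t))]
    have hper := integral_exp_half_mul_deriv_add_of_periodic hvr (hvper r) θ
    have hc : Continuous fun s ↦ v (r, θ + s) := hvr.continuous.comp (continuous_const_add θ)
    have hc' := hvr.continuous_deriv le_rfl
    simp only [mul_add] at hper
    rw [intervalIntegral.integral_add (Continuous.intervalIntegrable (by fun_prop) _ _)
      (Continuous.intervalIntegrable
        (by exact hexp.continuous.mul (continuous_const.mul hc)) _ _)] at hper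
    simp only [mul_left_comm _ (I / 2), intervalIntegral.integral_const_mul] at hper
    rw [h.deriv]
    simp only [hd]
    linear_combination (-I / 2) * hper +
      (∫ s in (0 : ℝ)..2 * Real.pi, exp (I * s / 2) * v (r, θ + s)) / 4 * I_sq
  · intro r hr θ
    have h := (hasDerivAt_intervalIntegral_of_contDiffOn isOpen_Ioo
      (F := fun r s : ℝ ↦ exp (I * s / 2) * v (r, θ + s))
      (((hexp.comp contDiff_snd).contDiffOn.mul <|
        hv.comp (f := fun q : ℝ × ℝ ↦ (q.1, θ + q.2)) (by fun_prop)
          fun q hq ↦ ⟨hq.1, Set.mem_univ _⟩).of_le (by simp))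
      0 (2 * Real.pi) hr).const_mul (1 / 2 : ℂ)
    rw [h.deriv]
    simp only [deriv_const_mul_field, hcompat r hr]
    rw [integral_exp_half_mul_deriv_add_of_periodic (slice hw hr) (hwper r) θ]
    ring
  · intro hreal r hr θ
    have hconj (s : ℝ) : starRingEnd ℂ (exp (I * s / 2) * v (r, θ + s)) =
        -exp (I * θ) * (exp (I * s / 2) * v (r, θ + s)) := by
      have hexps : exp (-(I * s / 2)) * exp (I * (θ + s : ℝ)) =
          exp (I * θ) * exp (I * s / 2) := by
        rw [← exp_add, ← exp_add]; congr 1; push_cast; ring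
      have he : starRingEnd ℂ (exp (I * s / 2)) = exp (-(I * s / 2)) := by
        rw [← exp_conj]; congr 1; simp [neg_div, conj_ofNat]
      rw [map_mul, he]
      linear_combination exp (-(I * s / 2)) * hreal r hr (θ + s) - v (r, θ + s) * hexps
    have hintegral : starRingEnd ℂ (∫ s in (0 : ℝ)..2 * Real.pi, exp (I * s / 2) * v (r, θ + s)) =
        -exp (I * θ) * ∫ s in (0 : ℝ)..2 * Real.pi, exp (I * s / 2) * v (r, θ + s) := by
      rw [← intervalIntegral.intervalIntegral_conj, ← intervalIntegral.integral_const_mul]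
      simp only [hconj]
    simp only [map_mul, hintegral, map_div₀, map_one, conj_ofNat]
    ring
end

section
/- For every ℓ ∈ ℤ and ν ∈ ℂ, the determinant of the 2×2 matrix [[−ℓ² − 1/4 + ν², −iℓ], [iℓ, −ℓ² − 1/4 + ν²]] vanishes if and only if ν² = (ℓ + 1/2)² or ν² = (ℓ − 1/2)². Consequently, for real ν, the set of all ν for which this determinant vanishes for some ℓ ∈ ℤ is exactly the set of half-odd-integers {k + 1/2 : k ∈ ℤ}. -/
open Complex

theorem indicial_det_eq_zero_iff (ℓ ν : ℂ) :
    (!![-ℓ ^ 2 - 1 / 4 + ν ^ 2, -I * ℓ;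
        I * ℓ, -ℓ ^ 2 - 1 / 4 + ν ^ 2]).det = 0 ↔
      (ν ^ 2 = (ℓ + 1 / 2) ^ 2 ∨ ν ^ 2 = (ℓ - 1 / 2) ^ 2) := by
  have factorization : (!![-ℓ ^ 2 - 1 / 4 + ν ^ 2, -I * ℓ;
      I * ℓ, -ℓ ^ 2 - 1 / 4 + ν ^ 2]).det =
      (ν ^ 2 - (ℓ + 1 / 2) ^ 2) * (ν ^ 2 - (ℓ - 1 / 2) ^ 2) := by
    rw [Matrix.det_fin_two_of]
    linear_combination ℓ ^ 2 * I_sq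
  rw [factorization, mul_eq_zero, sub_eq_zero, sub_eq_zero]

/-- The determinant `det [[-ℓ² - 1/4 + ν², -iℓ],[iℓ, -ℓ² - 1/4 + ν²]]` vanishes iff
`ν² = (ℓ + 1/2)²` or `ν² = (ℓ - 1/2)²`; consequently the real `ν` for which it vanishes
for some `ℓ ∈ ℤ` are exactly the half-odd-integers. -/
theorem indicial_root_determinant :
    (∀ (ℓ : ℤ) (ν : ℂ),
      (!![-(ℓ : ℂ) ^ 2 - 1 / 4 + ν ^ 2, -I * ℓ;
          I * ℓ, -(ℓ : ℂ) ^ 2 - 1 / 4 + ν ^ 2]).det = 0 ↔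
        (ν ^ 2 = ((ℓ : ℂ) + 1 / 2) ^ 2 ∨ ν ^ 2 = ((ℓ : ℂ) - 1 / 2) ^ 2)) ∧
    ({ν : ℝ | ∃ ℓ : ℤ,
        (!![-(ℓ : ℂ) ^ 2 - 1 / 4 + (ν : ℂ) ^ 2, -I * ℓ;
            I * ℓ, -(ℓ : ℂ) ^ 2 - 1 / 4 + (ν : ℂ) ^ 2]).det = 0}
      = {ν : ℝ | ∃ k : ℤ, ν = k + 1 / 2}) := by
  refine ⟨fun ℓ ν => indicial_det_eq_zero_iff ℓ ν, ?_⟩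
  ext ν
  simp only [Set.mem_ofPred_eq, indicial_det_eq_zero_iff, sq_eq_sq_iff_eq_or_eq_neg]
  constructor
  · rintro ⟨ℓ, (h | h) | (h | h)⟩
    · exact ⟨ℓ, ofReal_injective (by push_cast; exact h)⟩
    · refine ⟨-ℓ - 1, ofReal_injective ?_⟩
      push_cast
      linear_combination h
    · refine ⟨ℓ - 1, ofReal_injective ?_⟩
      push_cast
      linear_combination h
    · refine ⟨-ℓ, ofReal_injective ?_⟩
      push_cast
      linear_combination h
  · rintro ⟨k, rfl⟩
    exact ⟨k, Or.inl (Or.inl (by push_cast; rfl))⟩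
end

section
/- Let ψ : (0,∞) → ℝ be a smooth solution of ρ·ψ′(ρ) + ρ²·ψ″(ρ) = (1/2)·ρ²·sinh(2·ψ(ρ)) with ψ(ρ) ≥ 0 for all ρ > 0. Define η(ρ) = 1/8 + (3/8)·ρ·ψ′(ρ). Then η′(ρ) = (3/16)·ρ·sinh(2·ψ(ρ)) ≥ 0, so η is monotone nondecreasing. If moreover ρ·ψ′(ρ) → −1/3 as ρ → 0 and ρ·ψ′(ρ) → 0 as ρ → ∞, then η(ρ) → 0 as ρ → 0, η(ρ) → 1/8 as ρ → ∞, and 0 ≤ η(ρ) ≤ 1/8 for all ρ > 0. -/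
open Filter

/-- For a nonnegative solution `ψ` of the Painlevé-type equation, the function
`η(ρ) = 1/8 + (3/8)·ρ·ψ′(ρ)` has `η′ = (3/16)·ρ·sinh(2ψ) ≥ 0`, hence is monotone
nondecreasing; and under the stated asymptotics of `ρ·ψ′`, `η → 0` at `0`, `η → 1/8`
at `∞`, and `0 ≤ η ≤ 1/8`. -/
theorem eta_monotone_and_bounded
    (ψ : ℝ → ℝ)
    (hψ : ContDiffOn ℝ (⊤ : ℕ∞) ψ (Set.Ioi (0 : ℝ)))
    (hode : ∀ ρ > (0 : ℝ),
      ρ * deriv ψ ρ + ρ ^ 2 * deriv (deriv ψ) ρ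
        = (1 / 2) * ρ ^ 2 * Real.sinh (2 * ψ ρ))
    (hpos : ∀ ρ > (0 : ℝ), 0 ≤ ψ ρ)
    (η : ℝ → ℝ)
    (hη : ∀ ρ : ℝ, η ρ = 1 / 8 + (3 / 8) * ρ * deriv ψ ρ) :
    (∀ ρ > (0 : ℝ), deriv η ρ = (3 / 16) * ρ * Real.sinh (2 * ψ ρ) ∧ 0 ≤ deriv η ρ) ∧
    MonotoneOn η (Set.Ioi (0 : ℝ)) ∧
    ((Tendsto (fun ρ => ρ * deriv ψ ρ) (nhdsWithin 0 (Set.Ioi (0 : ℝ))) (nhds (-1 / 3)) ∧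
      Tendsto (fun ρ => ρ * deriv ψ ρ) atTop (nhds 0)) →
        (Tendsto η (nhdsWithin 0 (Set.Ioi (0 : ℝ))) (nhds 0) ∧
         Tendsto η atTop (nhds (1 / 8)) ∧
         ∀ ρ > (0 : ℝ), 0 ≤ η ρ ∧ η ρ ≤ 1 / 8)) := by
  have hd : ∀ ρ > (0 : ℝ), HasDerivAt η ((3 / 16) * ρ * Real.sinh (2 * ψ ρ)) ρ := by
    intro ρ hρ
    have hdd : DifferentiableAt ℝ (deriv ψ) ρ :=
      ((hψ.deriv_of_isOpen (m := 1) isOpen_Ioi (by norm_cast)).differentiableOn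
        one_ne_zero).differentiableAt (Ioi_mem_nhds hρ)
    have h := (((hasDerivAt_id ρ).const_mul (3 / 8 : ℝ)).mul hdd.hasDerivAt).const_add (1 / 8 : ℝ)
    rw [funext hη]
    refine h.congr_deriv (mul_left_cancel₀ hρ.ne' ?_)
    simp only [id]
    linear_combination (3 / 8) * hode ρ hρ
  have hnonneg : ∀ ρ > (0 : ℝ), 0 ≤ (3 / 16) * ρ * Real.sinh (2 * ψ ρ) := fun ρ hρ =>
    mul_nonneg (by positivity) (Real.sinh_nonneg_iff.2 (by linarith [hpos ρ hρ]))
  have hmono : MonotoneOn η (Set.Ioi (0 : ℝ)) := by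
    refine monotoneOn_of_deriv_nonneg (convex_Ioi 0)
      (fun ρ hρ => (hd ρ hρ).continuousAt.continuousWithinAt) ?_ ?_ <;>
      rw [interior_Ioi]
    · exact fun ρ hρ => (hd ρ hρ).differentiableAt.differentiableWithinAt
    · intro ρ hρ
      rw [(hd ρ hρ).deriv]
      exact hnonneg ρ hρ
  refine ⟨fun ρ hρ => ?_, hmono, fun ⟨h0, htop⟩ => ?_⟩
  · rw [(hd ρ hρ).deriv]
    exact ⟨rfl, hnonneg ρ hρ⟩
  have hη' : η = fun ρ => 1 / 8 + (3 / 8) * (ρ * deriv ψ ρ) := by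
    funext ρ
    rw [hη, mul_assoc]
  have h0η : Tendsto η (nhdsWithin 0 (Set.Ioi (0 : ℝ))) (nhds 0) := by
    rw [hη']
    convert (h0.const_mul (3 / 8 : ℝ)).const_add (1 / 8 : ℝ) using 2
    norm_num
  have htopη : Tendsto η atTop (nhds (1 / 8)) := by
    rw [hη']
    convert (htop.const_mul (3 / 8 : ℝ)).const_add (1 / 8 : ℝ) using 2
    norm_num
  refine ⟨h0η, htopη, fun ρ hρ => ⟨?_, ?_⟩⟩
  · refine le_of_tendsto h0η ?_
    filter_upwards [Ioo_mem_nhdsGT hρ] with x hx using hmono hx.1 hρ hx.2.le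
  · refine ge_of_tendsto htopη ?_
    filter_upwards [eventually_ge_atTop ρ] with x hx using hmono hρ (lt_of_lt_of_le hρ hx) hx
end

section
/- For φ ∈ Matrix (Fin 2) (Fin 2) ℂ, define the linear map M_φ : Matrix (Fin 2) (Fin 2) ℂ → Matrix (Fin 2) (Fin 2) ℂ by M_φ(γ) = 2·([φ*, [φ, γ]] + [φ, [φ*, γ]]), where φ* is the conjugate transpose and [A, B] = A·B − B·A. Then for every Hermitian matrix γ (γ = γ*), one has ⟨M_φ(γ), γ⟩ = 4·‖[φ, γ]‖², where ⟨A, B⟩ = Tr(A·B*) is the Frobenius inner product and ‖A‖² = Tr(A·A*). In particular M_φ(γ) = 0 for Hermitian γ if and only if [φ, γ] = 0. -/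
open scoped Matrix

/-- The commutator `[A, B] = A·B - B·A` of 2×2 complex matrices. -/
noncomputable def matComm (A B : Matrix (Fin 2) (Fin 2) ℂ) : Matrix (Fin 2) (Fin 2) ℂ :=
  A * B - B * A

/-- The potential term `M_φ(γ) = 2·([φ*, [φ, γ]] + [φ, [φ*, γ]])`. -/
noncomputable def Mpot (φ γ : Matrix (Fin 2) (Fin 2) ℂ) : Matrix (Fin 2) (Fin 2) ℂ :=
  (2 : ℂ) • (matComm φᴴ (matComm φ γ) + matComm φ (matComm φᴴ γ))

theorem trace_matComm_mul (A B C : Matrix (Fin 2) (Fin 2) ℂ) :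
    (matComm A B * C).trace = (B * matComm C A).trace := by
  simp only [matComm, sub_mul, mul_sub, Matrix.trace_sub, mul_assoc]
  rw [Matrix.trace_mul_comm A (B * C), mul_assoc]

theorem conjTranspose_matComm (A B : Matrix (Fin 2) (Fin 2) ℂ) :
    (matComm A B)ᴴ = matComm Bᴴ Aᴴ := by
  simp [matComm]

theorem matComm_antisymm (A B : Matrix (Fin 2) (Fin 2) ℂ) : matComm A B = -matComm B A := by
  simp [matComm]

theorem matComm_zero_right (A : Matrix (Fin 2) (Fin 2) ℂ) : matComm A 0 = 0 := by
  simp [matComm]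

theorem trace_Mpot_mul_conjTranspose (φ γ : Matrix (Fin 2) (Fin 2) ℂ) (hγ : γᴴ = γ) :
    (Mpot φ γ * γᴴ).trace = 4 * (matComm φ γ * (matComm φ γ)ᴴ).trace := by
  have h₁ : (matComm φᴴ (matComm φ γ) * γ).trace = (matComm φ γ * (matComm φ γ)ᴴ).trace := by
    rw [trace_matComm_mul, conjTranspose_matComm, hγ]
  have h₂ : (matComm φ (matComm φᴴ γ) * γ).trace = (matComm φ γ * (matComm φ γ)ᴴ).trace := by
    rw [trace_matComm_mul, conjTranspose_matComm, hγ, matComm_antisymm φᴴ γ,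
      matComm_antisymm γ φ, neg_mul_neg, Matrix.trace_mul_comm]
  rw [hγ, Mpot, smul_mul_assoc, add_mul, Matrix.trace_smul, Matrix.trace_add, h₁, h₂, smul_eq_mul]
  ring

/-- For Hermitian `γ`, `⟨M_φ(γ), γ⟩ = 4·‖[φ, γ]‖²` in the Frobenius inner product;
in particular `M_φ(γ) = 0` iff `[φ, γ] = 0`. -/
theorem Mpot_inner_self (φ γ : Matrix (Fin 2) (Fin 2) ℂ) (hγ : γᴴ = γ) :
    (Mpot φ γ * γᴴ).trace = 4 * (matComm φ γ * (matComm φ γ)ᴴ).trace ∧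
    (Mpot φ γ = 0 ↔ matComm φ γ = 0) := by
  refine ⟨trace_Mpot_mul_conjTranspose φ γ hγ, fun h => ?_, fun h => ?_⟩
  · have key := trace_Mpot_mul_conjTranspose φ γ hγ
    rw [h, zero_mul, Matrix.trace_zero] at key
    open scoped ComplexOrder in
    exact Matrix.trace_mul_conjTranspose_self_eq_zero_iff.mp
      ((mul_eq_zero.mp key.symm).resolve_left four_ne_zero)
  · have h' : matComm φᴴ γ = 0 := by
      rw [matComm_antisymm, ← hγ, ← conjTranspose_matComm, h, Matrix.conjTranspose_zero, neg_zero]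
    simp [Mpot, h, h', matComm_zero_right]
end

section
/- For φ ∈ Matrix (Fin 2) (Fin 2) ℂ with trace φ = 0, consider the ℝ-linear map M_φ(γ) = 2·([φ*, [φ, γ]] + [φ, [φ*, γ]]) on the real vector space of 2×2 Hermitian trace-free complex matrices (where φ* is the conjugate transpose and [A,B] = AB − BA). Then M_φ is invertible on this space if and only if [φ, φ*] ≠ 0 (i.e. φ is not normal). Moreover, if φ ≠ 0 and [φ, φ*] = 0, then the kernel of M_φ is one-dimensional over ℝ. -/
open scoped Matrix

open Complex

/-- The trace-free Hermitian matrix with real Pauli coordinates `v`. -/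
noncomputable def pauli : (Fin 3 → ℝ) →ₗ[ℝ] Matrix (Fin 2) (Fin 2) ℂ where
  toFun v := !![(v 2 : ℂ), v 0 - v 1 * I; v 0 + v 1 * I, -v 2]
  map_add' v w := by
    ext i j; fin_cases i <;> fin_cases j <;> simp <;> ring
  map_smul' c v := by
    ext i j; fin_cases i <;> fin_cases j <;> simp <;> ring

theorem pauli_apply (v : Fin 3 → ℝ) :
    pauli v = !![(v 2 : ℂ), v 0 - v 1 * I; v 0 + v 1 * I, -v 2] := rfl

theorem pauli_conjTranspose (v : Fin 3 → ℝ) : (pauli v)ᴴ = pauli v := by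
  ext i j; fin_cases i <;> fin_cases j <;> simp [pauli_apply, sub_eq_add_neg]

theorem pauli_trace (v : Fin 3 → ℝ) : (pauli v).trace = 0 := by
  simp [pauli_apply, Matrix.trace_fin_two]

theorem pauli_injective : Function.Injective pauli := by
  intro v w h
  have h0 := congrFun₂ h 1 0
  have h2 := congrFun₂ h 0 0
  simp only [pauli_apply, Matrix.of_apply, Matrix.cons_val', Matrix.cons_val_zero,
    Matrix.cons_val_one, Matrix.cons_val_fin_one, Complex.ext_iff] at h0 h2
  ext i
  fin_cases i <;> simp_all

theorem exists_pauli_eq {γ : Matrix (Fin 2) (Fin 2) ℂ} (hγ : γᴴ = γ) (htr : γ.trace = 0) :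
    ∃ v, pauli v = γ := by
  refine ⟨![(γ 1 0).re, (γ 1 0).im, (γ 0 0).re], ?_⟩
  have h00 := congrFun₂ hγ 0 0
  have h01 := congrFun₂ hγ 0 1
  rw [Matrix.trace_fin_two] at htr
  simp only [Matrix.conjTranspose_apply, RCLike.star_def, Complex.ext_iff, conj_re, conj_im,
    add_re, add_im, zero_re, zero_im] at h00 h01 htr
  ext i j
  fin_cases i <;> fin_cases j <;> apply Complex.ext <;> simp [pauli_apply] <;> linarith

theorem exists_pauli_add_eq {φ : Matrix (Fin 2) (Fin 2) ℂ} (htr : φ.trace = 0) :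
    ∃ x y, φ = pauli x + I • pauli y := by
  refine ⟨![((φ 0 1).re + (φ 1 0).re) / 2, ((φ 1 0).im - (φ 0 1).im) / 2, (φ 0 0).re],
    ![((φ 0 1).im + (φ 1 0).im) / 2, ((φ 0 1).re - (φ 1 0).re) / 2, (φ 0 0).im], ?_⟩
  rw [Matrix.trace_fin_two] at htr
  simp only [Complex.ext_iff, add_re, add_im, zero_re, zero_im] at htr
  ext i j
  fin_cases i <;> fin_cases j <;> apply Complex.ext <;>
    simp [pauli_apply, -ofReal_div, -ofReal_add, -ofReal_sub] <;> linarith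

theorem matComm_pauli (v w : Fin 3 → ℝ) :
    matComm (pauli v) (pauli w) = (2 * I) • pauli (v ⨯₃ w) := by
  ext i j
  fin_cases i <;> fin_cases j <;> apply Complex.ext <;>
    simp [matComm, pauli_apply, cross_apply] <;> ring

theorem conjTranspose_pauli_add (x y : Fin 3 → ℝ) :
    (pauli x + I • pauli y)ᴴ = pauli x - I • pauli y := by
  simp [pauli_conjTranspose, sub_eq_add_neg]

theorem matComm_conjTranspose_pauli_add (x y : Fin 3 → ℝ) :
    matComm (pauli x + I • pauli y) (pauli x + I • pauli y)ᴴ = (4 : ℝ) • pauli (x ⨯₃ y) := by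
  have h : matComm (pauli x + I • pauli y) (pauli x - I • pauli y) =
      (-2 * I) • matComm (pauli x) (pauli y) := by
    simp only [matComm, add_mul, mul_add, mul_sub, sub_mul, smul_mul_assoc, mul_smul_comm]
    module
  rw [conjTranspose_pauli_add, h, matComm_pauli, smul_smul,
    show -2 * I * (2 * I) = ((4 : ℝ) : ℂ) by push_cast; linear_combination -4 * I_mul_I, coe_smul]

/-- The operator `M_φ` for `φ = x + i y`, in Pauli coordinates. -/
noncomputable def crossPotential (x y : Fin 3 → ℝ) : (Fin 3 → ℝ) →ₗ[ℝ] (Fin 3 → ℝ) :=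
  (-16 : ℝ) • (crossProduct x ∘ₗ crossProduct x + crossProduct y ∘ₗ crossProduct y)

theorem Mpot_pauli (x y g : Fin 3 → ℝ) :
    Mpot (pauli x + I • pauli y) (pauli g) = pauli (crossPotential x y g) := by
  have h : Mpot (pauli x + I • pauli y) (pauli g) =
      (4 : ℂ) • (matComm (pauli x) (matComm (pauli x) (pauli g)) +
        matComm (pauli y) (matComm (pauli y) (pauli g))) := by
    have hI : I ^ 2 = -1 := I_sq
    rw [Mpot, conjTranspose_pauli_add]
    simp only [matComm, add_mul, mul_add, mul_sub, sub_mul, smul_mul_assoc, mul_smul_comm,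
      smul_add, smul_sub, smul_smul, mul_assoc, I_mul_I]
    module
  have hs (c : ℂ) (A B : Matrix (Fin 2) (Fin 2) ℂ) : matComm A (c • B) = c • matComm A B := by
    simp [matComm, smul_sub]
  have hc : (4 : ℂ) * (2 * I * (2 * I)) = ((-16 : ℝ) : ℂ) := by
    push_cast; linear_combination 16 * I_mul_I
  rw [h]
  simp only [matComm_pauli, hs, smul_smul, ← smul_add, hc, coe_smul, crossPotential]
  simp

theorem crossPotential_eq_zero_iff {x y g : Fin 3 → ℝ} :
    crossPotential x y g = 0 ↔ x ⨯₃ g = 0 ∧ y ⨯₃ g = 0 := by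
  constructor
  · intro h
    have key : g ⬝ᵥ crossPotential x y g =
        16 * (x ⨯₃ g ⬝ᵥ x ⨯₃ g + y ⨯₃ g ⬝ᵥ y ⨯₃ g) := by
      simp only [Matrix.vec3_dotProduct]
      simp [crossPotential, cross_apply]
      ring
    have nonneg (v : Fin 3 → ℝ) : 0 ≤ v ⬝ᵥ v :=
      Finset.sum_nonneg fun i _ ↦ mul_self_nonneg (v i)
    rw [h, dotProduct_zero] at key
    have hx := nonneg (x ⨯₃ g)
    have hy := nonneg (y ⨯₃ g)
    exact ⟨dotProduct_self_eq_zero.1 (by linarith), dotProduct_self_eq_zero.1 (by linarith)⟩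
  · rintro ⟨hx, hy⟩
    simp [crossPotential, hx, hy]

theorem exists_eq_smul_of_cross_eq_zero {v w : Fin 3 → ℝ} (hv : v ≠ 0) (h : v ⨯₃ w = 0) :
    ∃ c : ℝ, w = c • v := by
  have hne : v ⬝ᵥ v ≠ 0 := mt dotProduct_self_eq_zero.1 hv
  refine ⟨(v ⬝ᵥ w) / (v ⬝ᵥ v), ?_⟩
  have h0 := congrFun h 0
  have h1 := congrFun h 1
  have h2 := congrFun h 2
  simp [cross_apply] at h0 h1 h2
  ext i
  rw [Pi.smul_apply, smul_eq_mul, div_mul_eq_mul_div, eq_div_iff hne]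
  simp only [Matrix.vec3_dotProduct]
  fin_cases i <;> simp <;> grind

theorem crossPotential_injective {x y : Fin 3 → ℝ} (h : x ⨯₃ y ≠ 0) :
    Function.Injective (crossPotential x y) := by
  rw [← LinearMap.ker_eq_bot, LinearMap.ker_eq_bot']
  intro g hg
  obtain ⟨hx, hy⟩ := crossPotential_eq_zero_iff.1 hg
  obtain ⟨c, rfl⟩ := exists_eq_smul_of_cross_eq_zero (by rintro rfl; simp at h) hx
  have hyx : y ⨯₃ x ≠ 0 := by rwa [← cross_anticomm, neg_ne_zero]
  rw [map_smul, smul_eq_zero_iff_left hyx] at hy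
  rw [hy, zero_smul]

theorem exists_ker_crossPotential_eq_span {x y : Fin 3 → ℝ} (hne : x ≠ 0 ∨ y ≠ 0)
    (h : x ⨯₃ y = 0) :
    ∃ g, g ≠ 0 ∧ crossPotential x y g = 0 ∧
      ∀ w, crossPotential x y w = 0 → ∃ c : ℝ, w = c • g := by
  simp only [crossPotential_eq_zero_iff]
  rcases hne with hx | hy
  · have hyx : y ⨯₃ x = 0 := by rw [← cross_anticomm, h, neg_zero]
    exact ⟨x, hx, ⟨cross_self x, hyx⟩, fun w hw ↦ exists_eq_smul_of_cross_eq_zero hx hw.1⟩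
  · exact ⟨y, hy, ⟨h, cross_self y⟩, fun w hw ↦ exists_eq_smul_of_cross_eq_zero hy hw.2⟩

/-- For trace-free `φ`, the map `M_φ` on Hermitian trace-free matrices is invertible iff
`[φ, φ*] ≠ 0`; and if `φ ≠ 0` is normal, its kernel on that space is one-dimensional
over `ℝ`. -/
theorem Mpot_invertible_iff_not_normal
    (φ : Matrix (Fin 2) (Fin 2) ℂ) (hφ : φ.trace = 0) :
    (((∀ γ : Matrix (Fin 2) (Fin 2) ℂ, γᴴ = γ → γ.trace = 0 → Mpot φ γ = 0 → γ = 0) ∧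
      (∀ δ : Matrix (Fin 2) (Fin 2) ℂ, δᴴ = δ → δ.trace = 0 →
        ∃ γ : Matrix (Fin 2) (Fin 2) ℂ, γᴴ = γ ∧ γ.trace = 0 ∧ Mpot φ γ = δ)) ↔
      matComm φ φᴴ ≠ 0) ∧
    (φ ≠ 0 → matComm φ φᴴ = 0 →
      ∃ γ₀ : Matrix (Fin 2) (Fin 2) ℂ, γ₀ ≠ 0 ∧ γ₀ᴴ = γ₀ ∧ γ₀.trace = 0 ∧
        Mpot φ γ₀ = 0 ∧
        ∀ γ : Matrix (Fin 2) (Fin 2) ℂ, γᴴ = γ → γ.trace = 0 → Mpot φ γ = 0 →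
          ∃ c : ℝ, γ = c • γ₀) := by
  obtain ⟨x, y, rfl⟩ := exists_pauli_add_eq hφ
  have pauli_eq_zero {v} : pauli v = 0 ↔ v = 0 := map_eq_zero_iff _ pauli_injective
  have comm_eq_zero : matComm (pauli x + I • pauli y) (pauli x + I • pauli y)ᴴ = 0 ↔
      x ⨯₃ y = 0 := by
    rw [matComm_conjTranspose_pauli_add, smul_eq_zero_iff_right (by norm_num), pauli_eq_zero]
  rw [ne_eq, comm_eq_zero]
  refine ⟨⟨fun ⟨hinj, _⟩ h ↦ ?_, fun h ↦ ⟨fun γ hγ htr h0 ↦ ?_, fun δ hδ htr ↦ ?_⟩⟩,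
    fun hne h ↦ ?_⟩
  · have hker (g) (hg : crossPotential x y g = 0) : g = 0 := by
      refine pauli_eq_zero.1 (hinj _ (pauli_conjTranspose g) (pauli_trace g) ?_)
      rw [Mpot_pauli, hg, map_zero]
    by_cases hxy : x ≠ 0 ∨ y ≠ 0
    · obtain ⟨g, hg, hg0, -⟩ := exists_ker_crossPotential_eq_span hxy h
      exact hg (hker g hg0)
    · push Not at hxy
      exact one_ne_zero (hker 1 (crossPotential_eq_zero_iff.2 (by simp [hxy])))
  · obtain ⟨g, rfl⟩ := exists_pauli_eq hγ htr
    rw [Mpot_pauli, pauli_eq_zero] at h0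
    rw [crossPotential_injective h (h0.trans (map_zero _).symm), map_zero]
  · obtain ⟨d, rfl⟩ := exists_pauli_eq hδ htr
    obtain ⟨g, rfl⟩ := LinearMap.injective_iff_surjective.1 (crossPotential_injective h) d
    exact ⟨pauli g, pauli_conjTranspose g, pauli_trace g, Mpot_pauli x y g⟩
  · have hxy : x ≠ 0 ∨ y ≠ 0 := by
      contrapose! hne
      simp [hne]
    obtain ⟨g, hg, hg0, hspan⟩ := exists_ker_crossPotential_eq_span hxy h
    refine ⟨pauli g, mt pauli_eq_zero.1 hg, pauli_conjTranspose g, pauli_trace g,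
      by rw [Mpot_pauli, hg0, map_zero], fun γ hγ htr h0 ↦ ?_⟩
    obtain ⟨w, rfl⟩ := exists_pauli_eq hγ htr
    rw [Mpot_pauli, pauli_eq_zero] at h0
    obtain ⟨c, rfl⟩ := hspan w h0
    exact ⟨c, map_smul _ _ _⟩
end
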